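/- Let n ≥ 2, let h : ℝⁿ₊ → ℝ₊ be a twice continuously differentiable function that is homogeneous of degree d with d ≠ 0 and d ≠ 1, and let F : ℝ₊ → ℝ be twice continuously differentiable with F′ ≠ 0 everywhere. Then the homothetic function f = F ∘ h satisfies det(f_ij) = 0 at every point of ℝⁿ₊ (equivalently, the graph of f in ℝ^{n+1} has null Gauss–Kronecker curvature) if and only if either (i) h satisfies the homogeneous Monge–Ampère equation det(h_ij) = 0 at every point of ℝⁿ₊, or (ii) there exists a constant β such that f − β is homogeneous of degree 1. -/

import Mathlib

open Real

/-- Partial derivative of `f` in the `i`-th coordinate direction. -/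
noncomputable def pd {n : ℕ} (i : Fin n) (f : (Fin n → ℝ) → ℝ) (x : Fin n → ℝ) : ℝ :=
  fderiv ℝ f x (Pi.single i 1)

/-- Hessian matrix of second partial derivatives of `f` at `x`. -/
noncomputable def hess {n : ℕ} (f : (Fin n → ℝ) → ℝ) (x : Fin n → ℝ) :
    Matrix (Fin n) (Fin n) ℝ :=
  fun i j => pd i (pd j f) x

/-- Hessian determinant `det(f_ij)` of `f` at `x`. -/
noncomputable def hessDet {n : ℕ} (f : (Fin n → ℝ) → ℝ) (x : Fin n → ℝ) : ℝ :=
  (hess f x).det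

/-- The open positive orthant `ℝⁿ₊`. -/
def posOrth (n : ℕ) : Set (Fin n → ℝ) := {x | ∀ i, 0 < x i}

theorem posOrth_isOpen (n : ℕ) : IsOpen (posOrth n) := by
  have : posOrth n = ⋂ i, {x : Fin n → ℝ | 0 < x i} := by
    ext x; simp [posOrth]
  rw [this]
  exact isOpen_iInter_of_finite fun i => isOpen_lt continuous_const (continuous_apply i)

theorem posOrth_smul {n : ℕ} {t : ℝ} (ht : 0 < t) {x : Fin n → ℝ} (hx : x ∈ posOrth n) :
    t • x ∈ posOrth n := fun i => by
  have := hx i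
  simp only [Pi.smul_apply, smul_eq_mul]
  positivity

theorem pd_congr {n : ℕ} {f g : (Fin n → ℝ) → ℝ} (hfg : ∀ x ∈ posOrth n, f x = g x)
    (i : Fin n) {x : Fin n → ℝ} (hx : x ∈ posOrth n) : pd i f x = pd i g x := by
  have : f =ᶠ[nhds x] g := by
    filter_upwards [(posOrth_isOpen n).mem_nhds hx] with y hy using hfg y hy
  unfold pd
  rw [this.fderiv_eq]

theorem pd_hom {n : ℕ} {k : (Fin n → ℝ) → ℝ} {d : ℝ}
    (hk : DifferentiableOn ℝ k (posOrth n))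
    (hhom : ∀ t : ℝ, 0 < t → ∀ x ∈ posOrth n, k (t • x) = t ^ d * k x) (i : Fin n) :
    ∀ t : ℝ, 0 < t → ∀ x ∈ posOrth n, pd i k (t • x) = t ^ (d - 1) * pd i k x := by
  intro t ht x hx
  have h1 := pd_congr (f := fun y => k (t • y)) (g := fun y => t ^ d * k y) (hhom t ht) i hx
  have hd : DifferentiableAt ℝ k x := hk.differentiableAt ((posOrth_isOpen n).mem_nhds hx)
  have h2 : pd i (fun y => k (t • y)) x = t * pd i k (t • x) := by
    unfold pd
    rw [fderiv_comp_smul]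
    simp
  have h3 : pd i (fun y => t ^ d * k y) x = t ^ d * pd i k x := by
    unfold pd
    rw [fderiv_const_mul hd]
    simp
  rw [h2, h3] at h1
  rw [Real.rpow_sub_one ht.ne']
  field_simp
  linarith

theorem fderiv_eq_sum_pd {n : ℕ} (k : (Fin n → ℝ) → ℝ) (x v : Fin n → ℝ) :
    fderiv ℝ k x v = ∑ i, v i * pd i k x := by
  conv_lhs => rw [pi_eq_sum_univ' v]
  simp [pd, map_sum, Pi.single]

theorem euler {n : ℕ} {k : (Fin n → ℝ) → ℝ} {d : ℝ}
    (hk : DifferentiableOn ℝ k (posOrth n))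
    (hhom : ∀ t : ℝ, 0 < t → ∀ x ∈ posOrth n, k (t • x) = t ^ d * k x)
    {x : Fin n → ℝ} (hx : x ∈ posOrth n) : ∑ i, x i * pd i k x = d * k x := by
  rw [← fderiv_eq_sum_pd]
  have hd : DifferentiableAt ℝ k x := hk.differentiableAt ((posOrth_isOpen n).mem_nhds hx)
  have h1 : HasDerivAt (fun t : ℝ => t • x) x 1 := by
    simpa using (hasDerivAt_id (1 : ℝ)).smul_const x
  have h2 : HasDerivAt (fun t : ℝ => k (t • x)) (fderiv ℝ k x x) 1 := by
    have h3 : HasFDerivAt k (fderiv ℝ k x) ((1 : ℝ) • x) := by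
      rw [one_smul]; exact hd.hasFDerivAt
    exact h3.comp_hasDerivAt (1 : ℝ) h1
  have h4 : HasDerivAt (fun t : ℝ => t ^ d * k x) (d * k x) 1 := by
    have := (Real.hasDerivAt_rpow_const (x := 1) (p := d) (Or.inl one_ne_zero)).mul_const (k x)
    simpa using this
  have h5 : (fun t : ℝ => k (t • x)) =ᶠ[nhds 1] (fun t : ℝ => t ^ d * k x) := by
    filter_upwards [Ioi_mem_nhds (zero_lt_one' ℝ)] with t ht using hhom t ht x hx
  exact h2.unique (h4.congr_of_eventuallyEq h5)

theorem pd_diffOn {n : ℕ} {h : (Fin n → ℝ) → ℝ} (hC2 : ContDiffOn ℝ 2 h (posOrth n))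
    (i : Fin n) : DifferentiableOn ℝ (pd i h) (posOrth n) := by
  have h1 : ContDiffOn ℝ 1 (fderiv ℝ h) (posOrth n) :=
    hC2.fderiv_of_isOpen (posOrth_isOpen n) (by norm_num)
  exact (h1.differentiableOn (by norm_num)).clm_apply (differentiableOn_const _)

theorem F_facts {F : ℝ → ℝ} (hFC2 : ContDiffOn ℝ 2 F (Set.Ioi (0 : ℝ))) {u : ℝ} (hu : 0 < u) :
    HasDerivAt F (deriv F u) u ∧ HasDerivAt (deriv F) (deriv (deriv F) u) u := by
  have h1 : ContDiffOn ℝ 1 (deriv F) (Set.Ioi 0) :=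
    hFC2.deriv_of_isOpen isOpen_Ioi (by norm_num)
  exact ⟨((hFC2.differentiableOn (by norm_num)).differentiableAt (Ioi_mem_nhds hu)).hasDerivAt,
    ((h1.differentiableOn (by norm_num)).differentiableAt (Ioi_mem_nhds hu)).hasDerivAt⟩

theorem hess_comp {n : ℕ} {h : (Fin n → ℝ) → ℝ} (hC2 : ContDiffOn ℝ 2 h (posOrth n))
    (hpos : ∀ x ∈ posOrth n, 0 < h x)
    {F : ℝ → ℝ} (hFC2 : ContDiffOn ℝ 2 F (Set.Ioi (0 : ℝ)))
    {x : Fin n → ℝ} (hx : x ∈ posOrth n) (i j : Fin n) :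
    hess (fun y => F (h y)) x i j =
      deriv F (h x) * hess h x i j + deriv (deriv F) (h x) * (pd i h x * pd j h x) := by
  have hdiff : ∀ y ∈ posOrth n, HasFDerivAt h (fderiv ℝ h y) y := fun y hy =>
    ((hC2.differentiableOn (by norm_num)).differentiableAt
      ((posOrth_isOpen n).mem_nhds hy)).hasFDerivAt
  have e1 : ∀ y ∈ posOrth n, pd j (fun y => F (h y)) y = deriv F (h y) * pd j h y := by
    intro y hy
    have := (F_facts hFC2 (hpos y hy)).1.comp_hasFDerivAt y (hdiff y hy)
    unfold pd
    rw [show (fun y => F (h y)) = F ∘ h from rfl, this.fderiv]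
    simp
  have e2 := pd_congr e1 i hx
  unfold hess
  rw [e2]
  have a1 := (F_facts hFC2 (hpos x hx)).2.comp_hasFDerivAt x (hdiff x hx)
  have a2 : HasFDerivAt (pd j h) (fderiv ℝ (pd j h) x) x :=
    ((pd_diffOn hC2 j).differentiableAt ((posOrth_isOpen n).mem_nhds hx)).hasFDerivAt
  have a3 := a1.mul a2
  have : pd i (fun y => deriv F (h y) * pd j h y) x =
      (deriv F ∘ h) x * pd i (pd j h) x + pd j h x * (deriv (deriv F) (h x) * pd i h x) := by
    conv_lhs => unfold pd
    erw [a3.fderiv]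
    simp [pd]
  rw [this]
  simp only [Function.comp]
  ring

theorem hessDet_comp {n : ℕ} {d : ℝ} (hd1 : d ≠ 1)
    {h : (Fin n → ℝ) → ℝ} (hC2 : ContDiffOn ℝ 2 h (posOrth n))
    (hpos : ∀ x ∈ posOrth n, 0 < h x)
    (hhom : ∀ t : ℝ, 0 < t → ∀ x ∈ posOrth n, h (t • x) = t ^ d * h x)
    {F : ℝ → ℝ} (hFC2 : ContDiffOn ℝ 2 F (Set.Ioi (0 : ℝ)))
    (hF' : ∀ u : ℝ, 0 < u → deriv F u ≠ 0)
    {x : Fin n → ℝ} (hx : x ∈ posOrth n) :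
    hessDet (fun y => F (h y)) x = deriv F (h x) ^ n *
      (1 + deriv (deriv F) (h x) / deriv F (h x) / (d - 1) * (d * h x)) * hessDet h x := by
  have hd : d - 1 ≠ 0 := sub_ne_zero.2 hd1
  have hF := hF' _ (hpos x hx)
  have hdiff := hC2.differentiableOn (by norm_num)
  have eu1 := euler hdiff hhom hx
  have eu2 : ∀ j, ∑ i, x i * hess h x i j = (d - 1) * pd j h x := fun j =>
    euler (pd_diffOn hC2 j) (pd_hom hdiff hhom j) hx
  set c := deriv (deriv F) (h x) / deriv F (h x) / (d - 1) with hc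
  have key : hess (fun y => F (h y)) x = deriv F (h x) •
      ((1 + Matrix.replicateCol Unit (fun i => c * pd i h x) * Matrix.replicateRow Unit x)
        * hess h x) := by
    ext i j
    rw [hess_comp hC2 hpos hFC2 hx, Matrix.add_mul, Matrix.one_mul, Matrix.mul_assoc]
    have : (Matrix.replicateRow Unit x * hess h x) = Matrix.replicateRow Unit
        (fun j => (d - 1) * pd j h x) := by
      ext a j
      simp [Matrix.mul_apply, ← eu2]
    rw [this]
    simp [Matrix.mul_apply, hc]
    field_simp
  unfold hessDet
  rw [key, Matrix.det_smul, Matrix.det_mul, Matrix.det_one_add_replicateCol_mul_replicateRow]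
  have : x ⬝ᵥ (fun i => c * pd i h x) = c * (d * h x) := by
    rw [← eu1, Finset.mul_sum]
    exact Finset.sum_congr rfl fun i _ => by ring
  rw [this]
  simp
  ring

theorem hessDet_smul {n : ℕ} {d : ℝ}
    {h : (Fin n → ℝ) → ℝ} (hC2 : ContDiffOn ℝ 2 h (posOrth n))
    (hhom : ∀ t : ℝ, 0 < t → ∀ x ∈ posOrth n, h (t • x) = t ^ d * h x)
    {x : Fin n → ℝ} (hx : x ∈ posOrth n) {t : ℝ} (ht : 0 < t) :
    hessDet h (t • x) = (t ^ (d - 1 - 1)) ^ n * hessDet h x := by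
  have hdiff := hC2.differentiableOn (by norm_num)
  have : hess h (t • x) = t ^ (d - 1 - 1) • hess h x := by
    ext i j
    exact pd_hom (pd_diffOn hC2 j) (pd_hom hdiff hhom j) i t ht x hx
  unfold hessDet
  rw [this, Matrix.det_smul]
  simp

theorem exists_scale {d : ℝ} (hd0 : d ≠ 0) {a u : ℝ} (ha : 0 < a) (hu : 0 < u) :
    ∃ t : ℝ, 0 < t ∧ t ^ d * a = u := by
  refine ⟨(u / a) ^ (1 / d), by positivity, ?_⟩
  rw [← Real.rpow_mul (by positivity), one_div_mul_cancel hd0, Real.rpow_one]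
  field_simp

theorem const_of_deriv {G : ℝ → ℝ} (hG : ∀ u : ℝ, 0 < u → HasDerivAt G 0 u) {u : ℝ}
    (hu : 0 < u) : G u = G 1 := by
  refine isOpen_Ioi.is_const_of_deriv_eq_zero (s := Set.Ioi (0 : ℝ)) isPreconnected_Ioi
    (fun v hv => (hG v hv).differentiableAt.differentiableWithinAt)
    (fun v hv => (hG v hv).deriv) hu (Set.mem_Ioi.2 one_pos)

theorem ode_sol {d : ℝ} (hd0 : d ≠ 0)
    {F : ℝ → ℝ} (hFC2 : ContDiffOn ℝ 2 F (Set.Ioi (0 : ℝ)))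
    (hode : ∀ u : ℝ, 0 < u → (d - 1) * deriv F u + d * u * deriv (deriv F) u = 0) :
    ∃ β c : ℝ, ∀ u : ℝ, 0 < u → F u = β + c * u ^ (1 / d) := by
  have h1 : ∀ u : ℝ, 0 < u → F u - d * (u * deriv F u) = F 1 - d * (1 * deriv F 1) := by
    intro u hu
    refine const_of_deriv (G := fun u => F u - d * (u * deriv F u)) ?_ hu
    intro v hv
    obtain ⟨a, b⟩ := F_facts hFC2 hv
    have := a.sub (((hasDerivAt_id v).mul b).const_mul d)
    refine this.congr_deriv ?_
    have := hode v hv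
    simp only [id]
    linarith
  set β := F 1 - d * (1 * deriv F 1)
  refine ⟨β, (F 1 - β) * 1 ^ (-(1 / d)), fun u hu => ?_⟩
  have h2 : (F u - β) * u ^ (-(1 / d)) = (F 1 - β) * 1 ^ (-(1 / d)) := by
    refine const_of_deriv (G := fun u => (F u - β) * u ^ (-(1 / d))) ?_ hu
    intro v hv
    obtain ⟨a, b⟩ := F_facts hFC2 hv
    have := (a.sub_const β).mul (Real.hasDerivAt_rpow_const (x := v) (p := -(1 / d))
      (Or.inl hv.ne'))
    refine this.congr_deriv ?_
    have e := h1 v hv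
    have e' : F v - β = d * (v * deriv F v) := by linarith
    rw [e', Real.rpow_sub_one hv.ne']
    field_simp
    ring
  rw [← h2, mul_assoc, ← Real.rpow_add hu]
  simp

theorem ode_of_sol {d : ℝ} (hd0 : d ≠ 0) {F : ℝ → ℝ} {β c : ℝ}
    (hF : ∀ u : ℝ, 0 < u → F u = β + c * u ^ (1 / d)) {u : ℝ} (hu : 0 < u) :
    (d - 1) * deriv F u + d * u * deriv (deriv F) u = 0 := by
  have h1 : ∀ v : ℝ, 0 < v → deriv F v = c * (1 / d * v ^ (1 / d - 1)) := by
    intro v hv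
    have : F =ᶠ[nhds v] fun u => β + c * u ^ (1 / d) := by
      filter_upwards [Ioi_mem_nhds hv] with w hw using hF w hw
    rw [this.deriv_eq]
    exact (((Real.hasDerivAt_rpow_const (Or.inl hv.ne')).const_mul c).const_add β).deriv
  have h2 : deriv (deriv F) u = c * (1 / d * ((1 / d - 1) * u ^ (1 / d - 1 - 1))) := by
    have : deriv F =ᶠ[nhds u] fun v => c * (1 / d * v ^ (1 / d - 1)) := by
      filter_upwards [Ioi_mem_nhds hu] with w hw using h1 w hw
    rw [this.deriv_eq]
    exact (((Real.hasDerivAt_rpow_const (Or.inl hu.ne')).const_mul (1 / d)).const_mul c).deriv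
  rw [h1 u hu, h2, Real.rpow_sub_one hu.ne' (1 / d - 1)]
  field_simp
  ring

/-- For `n ≥ 2`, a C² function `h : ℝⁿ₊ → ℝ₊` homogeneous of degree `d`
(`d ≠ 0`, `d ≠ 1`), and a C² function `F : ℝ₊ → ℝ` with `F′ ≠ 0` everywhere, the
homothetic function `f = F ∘ h` satisfies `det(f_ij) = 0` on `ℝⁿ₊` (null Gauss–Kronecker
curvature of the graph) iff either (i) `det(h_ij) = 0` on `ℝⁿ₊`, or (ii) `f − β` is
homogeneous of degree 1 for some constant `β`. -/
theorem stmt_6 {n : ℕ} (hn : 2 ≤ n) (d : ℝ) (hd0 : d ≠ 0) (hd1 : d ≠ 1)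
    (h : (Fin n → ℝ) → ℝ)
    (hC2 : ContDiffOn ℝ 2 h (posOrth n))
    (hpos : ∀ x ∈ posOrth n, 0 < h x)
    (hhom : ∀ t : ℝ, 0 < t → ∀ x ∈ posOrth n, h (t • x) = t ^ d * h x)
    (F : ℝ → ℝ) (hFC2 : ContDiffOn ℝ 2 F (Set.Ioi (0 : ℝ)))
    (hF' : ∀ u : ℝ, 0 < u → deriv F u ≠ 0) :
    (∀ x ∈ posOrth n, hessDet (fun y => F (h y)) x = 0) ↔
      ((∀ x ∈ posOrth n, hessDet h x = 0) ∨
       (∃ β : ℝ, ∀ t : ℝ, 0 < t → ∀ x ∈ posOrth n,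
          F (h (t • x)) - β = t * (F (h x) - β))) := by
  have form := fun x (hx : x ∈ posOrth n) => hessDet_comp hd1 hC2 hpos hhom hFC2 hF' hx
  have hd : d - 1 ≠ 0 := sub_ne_zero.2 hd1
  constructor
  · intro H
    by_cases hz : ∀ x ∈ posOrth n, hessDet h x = 0
    · exact Or.inl hz
    right
    push Not at hz
    obtain ⟨x, hx, hne⟩ := hz
    have hode : ∀ u : ℝ, 0 < u → (d - 1) * deriv F u + d * u * deriv (deriv F) u = 0 := by
      intro u hu
      obtain ⟨t, ht, htu⟩ := exists_scale hd0 (hpos x hx) hu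
      have hy := posOrth_smul ht hx
      have e := form _ hy
      rw [H _ hy, hessDet_smul hC2 hhom hx ht, hhom t ht x hx, htu] at e
      have hFu := hF' u hu
      have htp : 0 < t ^ (d - 1 - 1) := Real.rpow_pos_of_pos ht _
      have e2 : 1 + deriv (deriv F) u / deriv F u / (d - 1) * (d * u) = 0 := by
        by_contra hcon
        exact (mul_ne_zero (mul_ne_zero (pow_ne_zero n hFu) hcon)
          (mul_ne_zero (pow_ne_zero n htp.ne') hne)) e.symm
      field_simp at e2
      linarith
    obtain ⟨β, c, hs⟩ := ode_sol hd0 hFC2 hode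
    refine ⟨β, fun t ht x hx => ?_⟩
    have hp := hpos x hx
    rw [hhom t ht x hx, hs _ hp, hs _ (by positivity),
      Real.mul_rpow (by positivity) hp.le, ← Real.rpow_mul ht.le, mul_one_div_cancel hd0,
      Real.rpow_one]
    ring
  · rintro (H | ⟨β, H⟩) x hx
    · rw [form x hx, H x hx, mul_zero]
    · have hp := hpos x hx
      have hs : ∀ u : ℝ, 0 < u →
          F u = β + ((F (h x) - β) / h x ^ (1 / d)) * u ^ (1 / d) := by
        intro u hu
        obtain ⟨t, ht, htu⟩ := exists_scale hd0 hp hu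
        have e := H t ht x hx
        rw [hhom t ht x hx] at e
        rw [← htu, Real.mul_rpow (by positivity) hp.le, ← Real.rpow_mul ht.le,
          mul_one_div_cancel hd0, Real.rpow_one]
        have : h x ^ (1 / d) ≠ 0 := (Real.rpow_pos_of_pos hp _).ne'
        field_simp
        linarith
      have e := ode_of_sol hd0 hs hp
      have hFu := hF' _ hp
      have : 1 + deriv (deriv F) (h x) / deriv F (h x) / (d - 1) * (d * h x) = 0 := by
        field_simp
        linarith
      rw [form x hx, this]
      ring
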